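/- Let r ≥ 0, T > 0, σ_Y > 0, γF ≥ 0, and suppose (β0, β1, β3, γ) is a C¹ solution on [0,T] of the system β0' = −2r·β0·β3, β1' = β3·[r(1 − 2β1) − β1·β3·γ/σ_Y²], β3' = β3·[r(1 − 2β3) + β1·β3·γ/σ_Y²], γ' = β3²·γ²/σ_Y², with initial conditions β0(0) = 0, β1(0) = β3(0) = 1/2, γ(0) = γF. Then β0(t) = 0 for all t. If γF > 0, then: β1(t) + β3(t) = 1 for all t ∈ [0,T]; β3(t) ∈ (1/2, 1) and β1(t) ∈ (0, 1/2) for all t ∈ (0,T]; β3 is monotonically increasing and β1 is monotonically decreasing; and γ is strictly increasing. If γF = 0, then β1(t) = β3(t) = 1/2 and γ(t) = 0 for all t ∈ [0,T]. -/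

import Mathlib

open Set

/-- Integrating factor of a linear equation `f' = a f + b` on `[0, T]`. -/
lemma exists_integratingFactor {T : ℝ} (hT : 0 < T) {a : ℝ → ℝ}
    (ha : ContinuousOn a (Icc 0 T)) :
    ∃ E : ℝ → ℝ, E 0 = 1 ∧ (∀ t, 0 < E t) ∧
      ∀ t ∈ Icc (0:ℝ) T, HasDerivWithinAt E (-(a t) * E t) (Icc 0 T) t := by
  have hc : Continuous (IccExtend hT.le ((Icc 0 T).domRestrict a)) :=
    (continuousOn_iff_continuous_domRestrict.1 ha).Icc_extend'
  refine ⟨fun t => Real.exp (-∫ s in (0:ℝ)..t, IccExtend hT.le ((Icc 0 T).domRestrict a) s),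
    by simp, fun t => Real.exp_pos _, fun t ht => ?_⟩
  have h := ((hc.integral_hasStrictDerivAt 0 t).hasDerivAt.neg.exp).hasDerivWithinAt
    (s := Icc 0 T)
  refine HasDerivWithinAt.congr_deriv h ?_
  rw [IccExtend_of_mem _ _ ht, domRestrict_apply, mul_comm]
  rfl

lemma monotoneOn_of_hasDerivWithinAt_Icc_nonneg {T : ℝ} {f f' : ℝ → ℝ}
    (hf : ∀ t ∈ Icc (0:ℝ) T, HasDerivWithinAt f (f' t) (Icc 0 T) t)
    (hf' : ∀ t ∈ Icc (0:ℝ) T, 0 ≤ f' t) : MonotoneOn f (Icc 0 T) :=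
  monotoneOn_of_hasDerivWithinAt_nonneg (convex_Icc 0 T)
    (fun t ht => (hf t ht).continuousWithinAt)
    (fun t ht => (hf t (interior_subset ht)).mono interior_subset)
    (fun t ht => hf' t (interior_subset ht))

lemma strictMonoOn_of_hasDerivWithinAt_Icc_pos {T : ℝ} {f f' : ℝ → ℝ}
    (hf : ∀ t ∈ Icc (0:ℝ) T, HasDerivWithinAt f (f' t) (Icc 0 T) t)
    (hf' : ∀ t ∈ Icc (0:ℝ) T, 0 < f' t) : StrictMonoOn f (Icc 0 T) :=
  strictMonoOn_of_hasDerivWithinAt_pos (convex_Icc 0 T)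
    (fun t ht => (hf t ht).continuousWithinAt)
    (fun t ht => (hf t (interior_subset ht)).mono interior_subset)
    (fun t ht => hf' t (interior_subset ht))

lemma hasDerivWithinAt_integratingFactor_mul {s : Set ℝ} {E f : ℝ → ℝ} {a b t : ℝ}
    (hE : HasDerivWithinAt E (-a * E t) s t)
    (hf : HasDerivWithinAt f (a * f t + b) s t) :
    HasDerivWithinAt (fun t => E t * f t) (E t * b) s t := by
  refine HasDerivWithinAt.congr_deriv (hE.mul hf) ?_
  ring

lemma exists_pos_forall_le_mul_of_linear_ode {T : ℝ} (hT : 0 < T) {f a b : ℝ → ℝ}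
    (ha : ContinuousOn a (Icc 0 T))
    (hf : ∀ t ∈ Icc (0:ℝ) T, HasDerivWithinAt f (a t * f t + b t) (Icc 0 T) t)
    (hb : ∀ t ∈ Icc (0:ℝ) T, 0 ≤ b t) :
    ∀ t ∈ Icc (0:ℝ) T, ∃ c : ℝ, 0 < c ∧ f 0 ≤ c * f t := by
  obtain ⟨E, hE0, hEpos, hE⟩ := exists_integratingFactor hT ha
  intro t ht
  refine ⟨E t, hEpos t, ?_⟩
  have h := monotoneOn_of_hasDerivWithinAt_Icc_nonneg
    (fun t ht => hasDerivWithinAt_integratingFactor_mul (hE t ht) (hf t ht))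
    (fun t ht => mul_nonneg (hEpos t).le (hb t ht)) (left_mem_Icc.2 hT.le) ht ht.1
  simpa [hE0] using h

lemma nonneg_of_linear_ode {T : ℝ} (hT : 0 < T) {f a b : ℝ → ℝ}
    (ha : ContinuousOn a (Icc 0 T))
    (hf : ∀ t ∈ Icc (0:ℝ) T, HasDerivWithinAt f (a t * f t + b t) (Icc 0 T) t)
    (hb : ∀ t ∈ Icc (0:ℝ) T, 0 ≤ b t) (h0 : 0 ≤ f 0) :
    ∀ t ∈ Icc (0:ℝ) T, 0 ≤ f t := by
  intro t ht
  obtain ⟨c, hc, h⟩ := exists_pos_forall_le_mul_of_linear_ode hT ha hf hb t ht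
  exact nonneg_of_mul_nonneg_right (h0.trans h) hc

lemma pos_of_linear_ode {T : ℝ} (hT : 0 < T) {f a b : ℝ → ℝ}
    (ha : ContinuousOn a (Icc 0 T))
    (hf : ∀ t ∈ Icc (0:ℝ) T, HasDerivWithinAt f (a t * f t + b t) (Icc 0 T) t)
    (hb : ∀ t ∈ Icc (0:ℝ) T, 0 ≤ b t) (h0 : 0 < f 0) :
    ∀ t ∈ Icc (0:ℝ) T, 0 < f t := by
  intro t ht
  obtain ⟨c, hc, h⟩ := exists_pos_forall_le_mul_of_linear_ode hT ha hf hb t ht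
  exact pos_of_mul_pos_right (h0.trans_le h) hc.le

lemma pos_of_linear_ode_of_forcing_pos {T : ℝ} (hT : 0 < T) {f a b : ℝ → ℝ}
    (ha : ContinuousOn a (Icc 0 T))
    (hf : ∀ t ∈ Icc (0:ℝ) T, HasDerivWithinAt f (a t * f t + b t) (Icc 0 T) t)
    (hb : ∀ t ∈ Icc (0:ℝ) T, 0 < b t) (h0 : f 0 = 0) :
    ∀ t ∈ Ioc (0:ℝ) T, 0 < f t := by
  obtain ⟨E, hE0, hEpos, hE⟩ := exists_integratingFactor hT ha
  intro t ht
  have h := strictMonoOn_of_hasDerivWithinAt_Icc_pos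
    (fun t ht => hasDerivWithinAt_integratingFactor_mul (hE t ht) (hf t ht))
    (fun t ht => mul_pos (hEpos t) (hb t ht)) (left_mem_Icc.2 hT.le) (Ioc_subset_Icc_self ht)
    ht.1
  simp only [h0, mul_zero] at h
  exact pos_of_mul_pos_right h (hEpos t).le

lemma eq_zero_of_linear_ode {T : ℝ} (hT : 0 < T) {f a : ℝ → ℝ}
    (ha : ContinuousOn a (Icc 0 T))
    (hf : ∀ t ∈ Icc (0:ℝ) T, HasDerivWithinAt f (a t * f t) (Icc 0 T) t)
    (h0 : f 0 = 0) :
    ∀ t ∈ Icc (0:ℝ) T, f t = 0 := by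
  intro t ht
  have h1 := nonneg_of_linear_ode (f := f) (b := fun _ => 0) hT ha
    (fun t ht => by simpa using hf t ht) (fun _ _ => le_rfl) h0.ge t ht
  have h2 := nonneg_of_linear_ode (f := fun t => -f t) (b := fun _ => 0) hT ha
    (fun t ht => (hf t ht).neg.congr_deriv (by ring)) (fun _ _ => le_rfl) (by simp [h0]) t ht
  linarith

/-- Properties of the backward (time-reversed) initial value problem for the
public-case leadership game (Cisternas–Kolb, Lemma A.1). -/
theorem stmt_10 (r T σY γF : ℝ) (hr : 0 ≤ r) (hT : 0 < T) (hσY : 0 < σY)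
    (hγF : 0 ≤ γF)
    (β0 β1 β3 γ : ℝ → ℝ)
    (hβ0C1 : ContDiffOn ℝ 1 β0 (Icc 0 T)) (hβ1C1 : ContDiffOn ℝ 1 β1 (Icc 0 T))
    (hβ3C1 : ContDiffOn ℝ 1 β3 (Icc 0 T)) (hγC1 : ContDiffOn ℝ 1 γ (Icc 0 T))
    (hβ0ode : ∀ t ∈ Icc (0:ℝ) T,
      HasDerivWithinAt β0 (-(2 * r * β0 t * β3 t)) (Icc 0 T) t)
    (hβ1ode : ∀ t ∈ Icc (0:ℝ) T,
      HasDerivWithinAt β1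
        (β3 t * (r * (1 - 2 * β1 t) - β1 t * β3 t * γ t / σY^2)) (Icc 0 T) t)
    (hβ3ode : ∀ t ∈ Icc (0:ℝ) T,
      HasDerivWithinAt β3
        (β3 t * (r * (1 - 2 * β3 t) + β1 t * β3 t * γ t / σY^2)) (Icc 0 T) t)
    (hγode : ∀ t ∈ Icc (0:ℝ) T,
      HasDerivWithinAt γ ((β3 t)^2 * (γ t)^2 / σY^2) (Icc 0 T) t)
    (hβ00 : β0 0 = 0) (hβ10 : β1 0 = 1/2) (hβ30 : β3 0 = 1/2) (hγ0 : γ 0 = γF) :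
    (∀ t ∈ Icc (0:ℝ) T, β0 t = 0) ∧
    (0 < γF →
      (∀ t ∈ Icc (0:ℝ) T, β1 t + β3 t = 1) ∧
      (∀ t ∈ Ioc (0:ℝ) T,
        (1/2 < β3 t ∧ β3 t < 1) ∧ (0 < β1 t ∧ β1 t < 1/2)) ∧
      MonotoneOn β3 (Icc 0 T) ∧ AntitoneOn β1 (Icc 0 T) ∧
      StrictMonoOn γ (Icc 0 T)) ∧
    (γF = 0 → ∀ t ∈ Icc (0:ℝ) T, β1 t = 1/2 ∧ β3 t = 1/2 ∧ γ t = 0) := by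
  have c1 := hβ1C1.continuousOn
  have c3 := hβ3C1.continuousOn
  have cγ := hγC1.continuousOn
  have h_sum : ∀ t ∈ Icc (0:ℝ) T, β1 t + β3 t - 1 = 0 := by
    refine eq_zero_of_linear_ode (a := fun t => -(2 * r * β3 t)) hT (by fun_prop)
      (fun t ht => ?_) (by rw [hβ10, hβ30]; norm_num)
    refine HasDerivWithinAt.congr_deriv (((hβ1ode t ht).add (hβ3ode t ht)).sub_const 1) ?_
    ring
  have cγa : ContinuousOn (fun t => β3 t ^ 2 * γ t / σY ^ 2) (Icc 0 T) := by fun_prop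
  refine ⟨?_, fun hpos => ?_, fun hzero => ?_⟩
  · refine eq_zero_of_linear_ode (a := fun t => -(2 * r * β3 t)) hT (by fun_prop)
      (fun t ht => ?_) hβ00
    refine HasDerivWithinAt.congr_deriv (hβ0ode t ht) ?_
    ring
  · have γ_pos : ∀ t ∈ Icc (0:ℝ) T, 0 < γ t := by
      refine pos_of_linear_ode (b := fun _ => 0) hT cγa (fun t ht => ?_)
        (fun _ _ => le_rfl) (hγ0 ▸ hpos)
      refine HasDerivWithinAt.congr_deriv (hγode t ht) ?_
      ring
    have β3_pos : ∀ t ∈ Icc (0:ℝ) T, 0 < β3 t := by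
      refine pos_of_linear_ode (b := fun _ => 0)
        (a := fun t => r * (1 - 2 * β3 t) + β1 t * β3 t * γ t / σY ^ 2) hT (by fun_prop)
        (fun t ht => ?_) (fun _ _ => le_rfl) (by rw [hβ30]; norm_num)
      refine HasDerivWithinAt.congr_deriv (hβ3ode t ht) ?_
      ring
    have β1_pos : ∀ t ∈ Icc (0:ℝ) T, 0 < β1 t := by
      refine pos_of_linear_ode (b := fun t => r * β3 t)
        (a := fun t => -(2 * r * β3 t + β3 t ^ 2 * γ t / σY ^ 2)) hT (by fun_prop)
        (fun t ht => ?_) (fun t ht => mul_nonneg hr (β3_pos t ht).le)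
        (by rw [hβ10]; norm_num)
      refine HasDerivWithinAt.congr_deriv (hβ1ode t ht) ?_
      ring
    have β3_gt : ∀ t ∈ Ioc (0:ℝ) T, 0 < β3 t - 1 / 2 := by
      refine pos_of_linear_ode_of_forcing_pos
        (b := fun t => β1 t * β3 t ^ 2 * γ t / σY ^ 2)
        (a := fun t => -(2 * r * β3 t)) hT (by fun_prop)
        (fun t ht => ?_) (fun t ht => ?_) (by rw [hβ30]; norm_num)
      · refine HasDerivWithinAt.congr_deriv ((hβ3ode t ht).sub_const (1 / 2)) ?_
        ring
      · have := β1_pos t ht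
        have := β3_pos t ht
        have := γ_pos t ht
        positivity
    -- The growth rate of `β3` solves a linear equation with nonnegative forcing.
    have rate_pos : ∀ t ∈ Icc (0:ℝ) T,
        0 < r * (1 - 2 * β3 t) + β1 t * β3 t * γ t / σY ^ 2 := by
      refine pos_of_linear_ode
        (f := fun t => r * (1 - 2 * β3 t) + β1 t * β3 t * γ t / σY ^ 2)
        (a := fun t => β3 t * (-(2 * r) + (β1 t - β3 t) * γ t / σY ^ 2))
        (b := fun t => β1 t * β3 t * (β3 t ^ 2 * γ t ^ 2 / σY ^ 2) / σY ^ 2) hT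
        (by fun_prop) (fun t ht => ?_) (fun t ht => ?_) ?_
      · have h3 := hβ3ode t ht
        have h := (((h3.const_mul 2).const_sub 1).const_mul r).add
          ((((hβ1ode t ht).mul h3).mul (hγode t ht)).div_const (σY ^ 2))
        refine HasDerivWithinAt.congr_deriv h ?_
        have e : β1 t = 1 - β3 t := by linarith [h_sum t ht]
        simp only [Pi.mul_apply, e]
        ring
      · have := β1_pos t ht
        have := β3_pos t ht
        have := γ_pos t ht
        positivity
      · simp only [hβ10, hβ30, hγ0]
        norm_num
        positivity
    have β3_mono : MonotoneOn β3 (Icc 0 T) :=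
      monotoneOn_of_hasDerivWithinAt_Icc_nonneg hβ3ode
        (fun t ht => (mul_pos (β3_pos t ht) (rate_pos t ht)).le)
    refine ⟨fun t ht => by linarith [h_sum t ht], fun t ht => ?_, β3_mono,
      fun s hs t ht hst => ?_, ?_⟩
    · have ht' := Ioc_subset_Icc_self ht
      have := β3_gt t ht
      have := β1_pos t ht'
      have := h_sum t ht'
      refine ⟨⟨?_, ?_⟩, ?_, ?_⟩ <;> linarith
    · linarith [β3_mono hs ht hst, h_sum s hs, h_sum t ht]
    · refine strictMonoOn_of_hasDerivWithinAt_Icc_pos hγode (fun t ht => ?_)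
      have := β3_pos t ht
      have := γ_pos t ht
      positivity
  · have γ_zero : ∀ t ∈ Icc (0:ℝ) T, γ t = 0 := by
      refine eq_zero_of_linear_ode hT cγa (fun t ht => ?_) (hγ0.trans hzero)
      refine HasDerivWithinAt.congr_deriv (hγode t ht) ?_
      ring
    have β3_half : ∀ t ∈ Icc (0:ℝ) T, β3 t - 1 / 2 = 0 := by
      refine eq_zero_of_linear_ode (a := fun t => -(2 * r * β3 t)) hT (by fun_prop)
        (fun t ht => ?_) (by rw [hβ30]; norm_num)
      refine HasDerivWithinAt.congr_deriv ((hβ3ode t ht).sub_const (1 / 2)) ?_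
      rw [γ_zero t ht]
      ring
    intro t ht
    have := h_sum t ht
    have := β3_half t ht
    exact ⟨by linarith, by linarith, γ_zero t ht⟩
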